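/- Let n ≥ 1 and let v : ℝⁿ → ℝⁿ and p : ℝⁿ → ℝ be measurable with |p| + |v|² integrable on ℝⁿ, and assume that for every ξ ≠ 0 the Fourier transforms satisfy p̂(ξ) = −Σ_{j,k=1}^n (ξ_j ξ_k / |ξ|²) · (v_j v_k)^(ξ). Then for every constant vector w ∈ ℝⁿ with |w| = 1 one has ∫_{ℝⁿ} p dx = −∫_{ℝⁿ} (v·w)² dx, where v·w denotes the Euclidean inner product. -/

import Mathlib

open MeasureTheory Real
open scoped FourierTransform RealInnerProductSpace

section FourierAtZero

variable {V : Type*} [NormedAddCommGroup V] [InnerProductSpace ℝ V] [FiniteDimensional ℝ V]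
  [MeasurableSpace V] [BorelSpace V]

theorem continuous_fourier_of_integrable {f : V → ℂ} (hf : Integrable f) : Continuous (𝓕 f) :=
  VectorFourier.fourierIntegral_continuous Real.continuous_fourierChar
    (by exact continuous_inner) hf

theorem fourier_zero_eq_integral (f : V → ℂ) : 𝓕 f 0 = ∫ x, f x := by
  simp [Real.fourier_eq]

theorem tendsto_fourier_smul_zero {f : V → ℂ} (hf : Integrable f) (w : V) :
    Filter.Tendsto (fun t : ℝ => 𝓕 f (t • w)) (nhdsWithin 0 {0}ᶜ) (nhds (∫ x, f x)) := by
  have hc : Continuous fun t : ℝ => 𝓕 f (t • w) :=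
    (continuous_fourier_of_integrable hf).comp (by fun_prop)
  simpa [fourier_zero_eq_integral] using (hc.tendsto 0).mono_left nhdsWithin_le_nhds

end FourierAtZero

theorem EuclideanSpace.real_inner_sq_eq_sum {ι : Type*} [Fintype ι] (u w : EuclideanSpace ℝ ι) :
    ⟪u, w⟫ ^ 2 = ∑ j, ∑ k, w j * w k * (u j * u k) := by
  simp only [PiLp.inner_apply, RCLike.inner_apply, conj_trivial, sq, Finset.sum_mul_sum]
  exact Finset.sum_congr rfl fun j _ => Finset.sum_congr rfl fun k _ => by ring

/-- If `p ∈ L¹`, `v_j v_k ∈ L¹` and on the Fourier side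
`p̂(ξ) = −Σ_{j,k} (ξ_j ξ_k / |ξ|²) (v_j v_k)^(ξ)` for all `ξ ≠ 0`, then for every unit
vector `w` one has `∫ p dx = −∫ (v·w)² dx`. -/
theorem integral_pressure_eq_neg_integral_sq
    (n : ℕ) (hn : 1 ≤ n)
    (v : EuclideanSpace ℝ (Fin n) → EuclideanSpace ℝ (Fin n))
    (p : EuclideanSpace ℝ (Fin n) → ℝ)
    (hv : Measurable v) (hp : Measurable p)
    (hpInt : Integrable p)
    (hvInt : ∀ j k : Fin n, Integrable (fun x => v x j * v x k))
    (hFourier : ∀ ξ : EuclideanSpace ℝ (Fin n), ξ ≠ 0 →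
      𝓕 (fun x => (p x : ℂ)) ξ =
        -∑ j : Fin n, ∑ k : Fin n,
          ((ξ j : ℂ) * (ξ k : ℂ) / (‖ξ‖ ^ 2 : ℝ)) *
            𝓕 (fun x => ((v x j * v x k : ℝ) : ℂ)) ξ) :
    ∀ w : EuclideanSpace ℝ (Fin n), ‖w‖ = 1 →
      ∫ x, p x = -∫ x, (⟪v x, w⟫ : ℝ) ^ 2 := by
  intro w hw
  have hw0 : w ≠ 0 := norm_ne_zero_iff.mp (by simp [hw])
  have hlhs := tendsto_fourier_smul_zero hpInt.ofReal w
  have hrhs : Filter.Tendsto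
      (fun t : ℝ => -∑ j, ∑ k, (w j : ℂ) * w k *
        𝓕 (fun x => ((v x j * v x k : ℝ) : ℂ)) (t • w)) (nhdsWithin 0 {0}ᶜ)
      (nhds (-∑ j, ∑ k, (w j : ℂ) * w k * ∫ x, ((v x j * v x k : ℝ) : ℂ))) :=
    (tendsto_finsetSum _ fun j _ => tendsto_finsetSum _ fun k _ =>
      (tendsto_fourier_smul_zero (hvInt j k).ofReal w).const_mul _).neg
  have hray : (fun t : ℝ => 𝓕 (fun x => (p x : ℂ)) (t • w)) =ᶠ[nhdsWithin 0 {0}ᶜ]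
      fun t : ℝ => -∑ j, ∑ k, (w j : ℂ) * w k *
        𝓕 (fun x => ((v x j * v x k : ℝ) : ℂ)) (t • w) := by
    filter_upwards [self_mem_nhdsWithin] with t ht
    have ht0 : (t : ℂ) ≠ 0 := Complex.ofReal_ne_zero.mpr ht
    rw [hFourier _ (smul_ne_zero ht hw0)]
    refine congrArg Neg.neg (Finset.sum_congr rfl fun j _ => Finset.sum_congr rfl fun k _ => ?_)
    congr 1
    simp only [norm_smul, hw, mul_one, Real.norm_eq_abs, sq_abs, PiLp.smul_apply, smul_eq_mul]
    push_cast
    field_simp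
  have hlim := tendsto_nhds_unique hlhs (hrhs.congr' hray.symm)
  have hreal : ∫ x, p x = -∑ j, ∑ k, w j * w k * ∫ x, v x j * v x k := by
    simp only [RCLike.ofReal_eq_complex_ofReal, integral_complex_ofReal] at hlim
    exact_mod_cast hlim
  rw [hreal]
  simp only [EuclideanSpace.real_inner_sq_eq_sum]
  rw [integral_finsetSum _ fun j _ => integrable_finsetSum _ fun k _ => (hvInt j k).const_mul _]
  congr! 2 with j _
  rw [integral_finsetSum _ fun k _ => (hvInt j k).const_mul _]
  simp only [integral_const_mul]
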